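/- Suppose N₂ = 4 and p ≡ 3 (mod 4). Then k = sm is even and C(r,N) is a two-weight code: (r-1)/4 nonzero codewords have weight (q-1)(r + (-1)^{k/2}·3√r)/(Nq) and 3(r-1)/4 have weight (q-1)(r - (-1)^{k/2}·√r)/(Nq). -/

import Mathlib

open scoped Classical

/-- The Hamming weight of the codeword `c(β) = (Tr_{r/q}(βθʲ))_{j=0}^{n-1}`. -/
noncomputable def codewordWeight (K F : Type) [Field K] [Field F] [Algebra K F]
    (θ : F) (n : ℕ) (β : F) : ℕ :=
  (Finset.univ.filter fun j : Fin n => Algebra.trace K F (β * θ ^ (j : ℕ)) ≠ 0).card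

section CyclicGroup

variable {G : Type*} [CommGroup G] [Fintype G] {A : Type*} [AddCommMonoid A]

theorem sum_eq_sum_range_pow_generator {a : G} (ha : ∀ x : G, x ∈ Subgroup.zpowers a)
    (f : G → A) : ∑ x, f x = ∑ i ∈ Finset.range (Fintype.card G), f (a ^ i) := by
  have ho : orderOf a = Fintype.card G := by
    rw [orderOf_eq_card_of_forall_mem_zpowers ha, Nat.card_eq_fintype_card]
  rw [← IsCyclic.image_range_card ha, Finset.sum_image, Nat.card_eq_fintype_card]
  intro i hi j hj h
  rw [Nat.card_eq_fintype_card, ← ho] at hi hj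
  exact pow_injOn_Iio_orderOf (by simpa using hi) (by simpa using hj) h

theorem sum_range_mul_of_periodic {g : ℕ → A} {n : ℕ} (hg : ∀ i, g (i + n) = g i) (N : ℕ) :
    ∑ i ∈ Finset.range (n * N), g i = N • ∑ i ∈ Finset.range n, g i := by
  induction N with
  | zero => simp
  | succ N ih =>
    have h : ∀ N i, g (n * N + i) = g i := by
      intro N i
      induction N with
      | zero => simp
      | succ N ih => rw [← ih, ← hg (n * N + i)]; congr 1; ring
    rw [Nat.mul_succ, Finset.sum_range_add, ih, succ_nsmul]
    simp only [h]

theorem sum_pow_eq_nsmul_sum_range {a : G} (ha : ∀ x : G, x ∈ Subgroup.zpowers a) {N : ℕ}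
    (hN : N ∣ Fintype.card G) (f : G → A) :
    ∑ x : G, f (x ^ N) = N • ∑ j ∈ Finset.range (Fintype.card G / N), f ((a ^ N) ^ j) := by
  rw [sum_eq_sum_range_pow_generator ha]
  conv_lhs => rw [← Nat.div_mul_cancel hN]
  rw [sum_range_mul_of_periodic]
  · simp only [← pow_mul, mul_comm]
  · intro i
    rw [← pow_mul, ← pow_mul, add_mul, pow_add, Nat.div_mul_cancel hN, pow_card_eq_one, mul_one]

theorem sum_eq_nsmul_sum_cosets {a : G} (ha : ∀ x : G, x ∈ Subgroup.zpowers a) {d : ℕ}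
    (hd : d ∣ Fintype.card G) {f : G → A} (hf : ∀ x y, f (x * y ^ d) = f x) :
    ∑ x, f x = (Fintype.card G / d) • ∑ i ∈ Finset.range d, f (a ^ i) := by
  rw [sum_eq_sum_range_pow_generator ha]
  conv_lhs => rw [← Nat.mul_div_cancel' hd]
  rw [sum_range_mul_of_periodic]
  intro i
  rw [pow_add, hf]

theorem sum_comp_of_surjective {H : Type*} [Group H] [Fintype H] (φ : H →* G)
    (hφ : Function.Surjective φ) (f : G → ℕ) :
    Fintype.card G * ∑ h, f (φ h) = Fintype.card H * ∑ g, f g := by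
  have key : ∀ g, (Finset.univ.filter fun h => φ h = g).card * Fintype.card G
      = Fintype.card H := by
    intro g
    have h1 : ∀ g', (Finset.univ.filter fun h => φ h = g').card
        = (Finset.univ.filter fun h => φ h = g).card := fun g' =>
      MonoidHom.card_fiber_eq_of_mem_range φ (hφ g') (hφ g)
    have h2 := Finset.card_eq_sum_card_fiberwise (f := φ) (s := Finset.univ) (t := Finset.univ)
      (fun _ _ => Finset.mem_coe.2 (Finset.mem_univ _))
    simp only [h1, Finset.sum_const, Finset.card_univ, smul_eq_mul] at h2
    rw [h2, mul_comm]
  rw [← Finset.sum_fiberwise Finset.univ φ, Finset.mul_sum, Finset.mul_sum]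
  refine Finset.sum_congr rfl fun g _ => ?_
  rw [Finset.sum_congr rfl (g := fun _ => f g)
    (fun h hh => by rw [(Finset.mem_filter.1 hh).2]), Finset.sum_const, ← key g, smul_eq_mul]
  ring

/-- If `f` is invariant under `M`-th powers, its sum over `N`-th powers only depends on
`gcd N M`. -/
theorem sum_pow_eq_sum_pow_gcd {N M : ℕ} (hd : 0 < N.gcd M) {f : G → ℕ}
    (hf : ∀ x y, f (x * y ^ M) = f x) : ∑ x, f (x ^ N) = ∑ x, f (x ^ N.gcd M) := by
  obtain ⟨N', hN'⟩ := N.gcd_dvd_left M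
  obtain ⟨M', hM'⟩ := N.gcd_dvd_right M
  generalize hdd : N.gcd M = d at *
  have hb : (d : ℤ) = N * N.gcdA M + M * N.gcdB M := by rw [← hdd]; exact Nat.gcd_eq_gcd_ab N M
  have hbez : (N' : ℤ) * N.gcdA M + M' * N.gcdB M = 1 := by
    have : (d : ℤ) * (N' * N.gcdA M + M' * N.gcdB M) = d * 1 := by
      have e1 : (N : ℤ) = d * N' := by exact_mod_cast hN'
      have e2 : (M : ℤ) = d * M' := by exact_mod_cast hM'
      calc _ = (d * N' : ℤ) * N.gcdA M + (d * M') * N.gcdB M := by ring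
        _ = _ := by rw [← e1, ← e2, mul_one, ← hb]
    exact mul_left_cancel₀ (by exact_mod_cast hd.ne') this
  let φ : G × G →* G :=
    { toFun := fun z => z.1 ^ N' * z.2 ^ M'
      map_one' := by simp
      map_mul' := fun z w => by
        simp only [Prod.fst_mul, Prod.snd_mul, mul_pow]
        exact mul_mul_mul_comm _ _ _ _ }
  have hφ : Function.Surjective φ := fun g => ⟨(g ^ N.gcdA M, g ^ N.gcdB M), by
    change (g ^ N.gcdA M) ^ N' * (g ^ N.gcdB M) ^ M' = g
    rw [← zpow_natCast, ← zpow_natCast, ← zpow_mul, ← zpow_mul, ← zpow_add,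
      mul_comm _ (N' : ℤ), mul_comm _ (M' : ℤ), hbez, zpow_one]⟩
  have h := sum_comp_of_surjective φ hφ fun g => f (g ^ d)
  have h2 : ∀ z : G × G, f (φ z ^ d) = f (z.1 ^ N) := by
    intro z
    change f ((z.1 ^ N' * z.2 ^ M') ^ d) = _
    rw [mul_pow, ← pow_mul, ← pow_mul, mul_comm N', mul_comm M', ← hN', ← hM', hf]
  simp only [h2, Fintype.sum_prod_type, Finset.sum_const, Finset.card_univ, smul_eq_mul,
    Fintype.card_prod, ← Finset.mul_sum] at h
  have hc : Fintype.card G * Fintype.card G ≠ 0 := by simp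
  rw [← mul_assoc] at h
  exact mul_left_cancel₀ hc h

end CyclicGroup

section PowerSums

variable {K F : Type*} [Field K] [Fintype K] [Field F] [Fintype F] [Algebra K F]

/-- The character sum `∑ x, ψ (b * x ^ d)` over a finite field. -/
noncomputable def powerCharSum (ψ : AddChar F ℂ) (d : ℕ) (b : F) : ℂ :=
  ∑ x, ψ (b * x ^ d)

/-- The number of `x` such that the trace of `b * x ^ d` vanishes. -/
noncomputable def traceZeroCount (K : Type*) {F : Type*} [Field K] [Field F] [Fintype F]
    [Algebra K F] (d : ℕ) (b : F) : ℕ :=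
  (Finset.univ.filter fun x : F => Algebra.trace K F (b * x ^ d) = 0).card

theorem powerCharSum_mul_pow (ψ : AddChar F ℂ) (d : ℕ) (b : F) {y : F} (hy : y ≠ 0) :
    powerCharSum ψ d (b * y ^ d) = powerCharSum ψ d b :=
  Fintype.sum_equiv (Equiv.mulLeft₀ y hy) _ _ fun x => by
    simp [mul_pow, mul_assoc]

theorem powerCharSum_zero (ψ : AddChar F ℂ) (d : ℕ) :
    powerCharSum ψ d 0 = Fintype.card F := by
  simp [powerCharSum]

theorem sum_eq_zero_add_sum_units {A : Type*} [AddCommMonoid A] (f : F → A) :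
    ∑ x, f x = f 0 + ∑ x : Fˣ, f x := by
  rw [← Fintype.sum_equiv unitsEquivNeZero.symm (fun x : {x : F // x ≠ 0} => f x)
    (fun x : Fˣ => f x) (fun x => by simp), ← Finset.add_sum_erase _ _ (Finset.mem_univ (0 : F))]
  congr 1
  exact Finset.sum_subtype _ (by simp) _

theorem sum_powerCharSum {ψ : AddChar F ℂ} (hψ : ψ.IsPrimitive) {d : ℕ} (hd : d ≠ 0) :
    ∑ b, powerCharSum ψ d b = Fintype.card F := by
  unfold powerCharSum
  rw [Finset.sum_comm]
  simp [AddChar.sum_mulShift _ hψ, hd]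

/-- Correlation of two power sums whose arguments differ by a factor `c`. -/
theorem sum_powerCharSum_mul_powerCharSum {ψ : AddChar F ℂ} (hψ : ψ.IsPrimitive) {d : ℕ}
    (hd : d ≠ 0) {c : F} (hc : ∀ x, x ^ d ≠ c) :
    ∑ b, powerCharSum ψ d b * powerCharSum ψ d (-(c * b)) = Fintype.card F := by
  unfold powerCharSum
  have h1 : ∀ b : F, (∑ x, ψ (b * x ^ d)) * (∑ y, ψ (-(c * b) * y ^ d))
      = ∑ x, ∑ y, ψ (b * (x ^ d - c * y ^ d)) := by
    intro b
    rw [Finset.sum_mul_sum]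
    refine Finset.sum_congr rfl fun x _ => Finset.sum_congr rfl fun y _ => ?_
    rw [← AddChar.map_add_eq_mul]
    congr 1
    ring
  have h2 : ∀ x y : F, x ^ d - c * y ^ d = 0 ↔ x = 0 ∧ y = 0 := by
    intro x y
    constructor
    · intro h
      have hy : y = 0 := by
        by_contra hy
        refine hc (x / y) ?_
        rw [div_pow, div_eq_iff (pow_ne_zero _ hy)]
        exact sub_eq_zero.1 h
      subst hy
      simpa [hd] using h
    · rintro ⟨rfl, rfl⟩
      simp [hd]
  simp only [h1]
  rw [Finset.sum_comm]
  have h3 : ∀ x : F, ∑ b, ∑ y, ψ (b * (x ^ d - c * y ^ d))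
      = if x = 0 then (Fintype.card F : ℂ) else 0 := by
    intro x
    rw [Finset.sum_comm]
    simp only [AddChar.sum_mulShift _ hψ, h2]
    split_ifs with hx <;> simp [hx]
  simp [h3]

theorem isIntegral_addChar (ψ : AddChar F ℂ) (x : F) : IsIntegral ℤ (ψ x) := by
  refine IsIntegral.of_pow (n := Fintype.card F) Fintype.card_pos ?_
  rw [← AddChar.map_nsmul_eq_pow, card_nsmul_eq_zero, AddChar.map_zero_eq_one]
  exact isIntegral_one

theorem exists_isIntegral_powerCharSum_eq (ψ : AddChar F ℂ) {d : ℕ} (hd0 : d ≠ 0)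
    (hd : d ∣ Fintype.card Fˣ) (b : F) :
    ∃ η : ℂ, IsIntegral ℤ η ∧ powerCharSum ψ d b = 1 + d * η := by
  obtain ⟨a, ha⟩ := IsCyclic.exists_generator (α := Fˣ)
  refine ⟨∑ j ∈ Finset.range (Fintype.card Fˣ / d), ψ (b * (((a ^ d) ^ j : Fˣ) : F)),
    IsIntegral.sum _ fun j _ => isIntegral_addChar ψ _, ?_⟩
  rw [powerCharSum, sum_eq_zero_add_sum_units]
  have := sum_pow_eq_nsmul_sum_range ha hd fun x : Fˣ => ψ (b * (x : F))
  simp only [Units.val_pow_eq_pow_val, nsmul_eq_mul] at this ⊢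
  rw [this]
  simp [hd0]

theorem sum_powerCharSum_algebraMap_mul {χ : AddChar K ℂ} (hχ : χ.IsPrimitive) (d : ℕ) (b : F) :
    ∑ c : K, powerCharSum (χ.compAddMonoidHom (Algebra.trace K F).toAddMonoidHom) d
      (algebraMap K F c * b) = Fintype.card K * traceZeroCount K d b := by
  unfold powerCharSum traceZeroCount
  rw [Finset.sum_comm]
  have h : ∀ (c : K) (x : F), (χ.compAddMonoidHom (Algebra.trace K F).toAddMonoidHom)
      (algebraMap K F c * b * x ^ d) = χ (c * Algebra.trace K F (b * x ^ d)) := by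
    intro c x
    rw [mul_assoc, ← Algebra.smul_def]
    simp
  simp only [h, AddChar.sum_mulShift _ hχ]
  rw [Finset.card_filter]
  push_cast
  rw [Finset.mul_sum]
  simp

theorem isPrimitive_comp_trace {χ : AddChar K ℂ} (hχ : χ.IsPrimitive) :
    (χ.compAddMonoidHom (Algebra.trace K F).toAddMonoidHom).IsPrimitive := by
  apply AddChar.IsPrimitive.of_ne_one
  intro h
  have h1 := hχ one_ne_zero
  apply h1
  ext x
  obtain ⟨y, rfl⟩ := Algebra.trace_surjective K F x
  have := DFunLike.congr_fun h y
  simpa using this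

omit [Fintype K] in
theorem traceZeroCount_pow_char (p : ℕ) [Fact p.Prime] [CharP F p] (d : ℕ) (b : F) :
    traceZeroCount K d (b ^ p) = traceZeroCount K d b := by
  have htr : ∀ x : F, Algebra.trace K F (x ^ p) = 0 ↔ Algebra.trace K F x = 0 := by
    intro x
    have h : algebraMap K F (Algebra.trace K F (x ^ p))
        = (algebraMap K F (Algebra.trace K F x)) ^ p := by
      rw [FiniteField.algebraMap_trace_eq_sum_pow, FiniteField.algebraMap_trace_eq_sum_pow,
        sum_pow_char]
      exact Finset.sum_congr rfl fun i _ => pow_right_comm _ _ _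
    rw [← map_eq_zero (algebraMap K F), h, pow_eq_zero_iff (Fact.out : p.Prime).ne_zero,
      map_eq_zero]
  unfold traceZeroCount
  symm
  refine Finset.card_equiv (frobeniusEquiv F p).toEquiv fun x => ?_
  simp only [Finset.mem_filter, Finset.mem_univ, true_and, RingEquiv.toEquiv_eq_coe,
    EquivLike.coe_coe, frobeniusEquiv_apply, frobenius_def]
  rw [pow_right_comm, ← mul_pow, htr]

/-- If the elements of `K` are `d`-th powers in `F`, the power sums are integers congruent to `1`
modulo `d`, and they determine the number of zeros of the trace. -/
theorem exists_int_powerCharSum_eq {χ : AddChar K ℂ} (hχ : χ.IsPrimitive) {d : ℕ} (hd0 : d ≠ 0)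
    (hd : d ∣ Fintype.card Fˣ) (hK : ∀ c : K, ∃ y : F, y ^ d = algebraMap K F c) :
    ∃ e : F → ℤ, ∀ b,
      powerCharSum (χ.compAddMonoidHom (Algebra.trace K F).toAddMonoidHom) d b
        = ((1 + d * e b : ℤ) : ℂ) ∧
      ((Fintype.card K : ℤ) - 1) * (1 + d * e b)
        = Fintype.card K * traceZeroCount K d b - Fintype.card F := by
  set ψ := χ.compAddMonoidHom (Algebra.trace K F).toAddMonoidHom with hψ
  have key : ∀ b, ((Fintype.card K : ℂ) - 1) * powerCharSum ψ d b
      = Fintype.card K * traceZeroCount K d b - Fintype.card F := by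
    intro b
    have h := sum_powerCharSum_algebraMap_mul (F := F) hχ d b
    rw [sum_eq_zero_add_sum_units, ← hψ] at h
    have h1 : ∀ c : Kˣ, powerCharSum ψ d (algebraMap K F c * b) = powerCharSum ψ d b := by
      intro c
      obtain ⟨y, hy⟩ := hK c
      rw [← hy, mul_comm]
      refine powerCharSum_mul_pow ψ d b ?_
      rintro rfl
      rw [zero_pow hd0] at hy
      exact c.ne_zero ((map_eq_zero (algebraMap K F)).1 hy.symm)
    simp only [h1, map_zero, zero_mul, powerCharSum_zero, Finset.sum_const, Finset.card_univ,
      nsmul_eq_mul] at h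
    rw [Fintype.card_units, Nat.cast_sub Fintype.card_pos, Nat.cast_one] at h
    rw [← h]
    ring
  have hint : ∀ b, ∃ e : ℤ, powerCharSum ψ d b = ((1 + d * e : ℤ) : ℂ) := by
    intro b
    obtain ⟨η, hη, hS⟩ := exists_isIntegral_powerCharSum_eq ψ hd0 hd b
    have hd' : (d : ℂ) ≠ 0 := by exact_mod_cast hd0
    have hrat : η = algebraMap ℚ ℂ (((Fintype.card K * traceZeroCount K d b - Fintype.card F) /
        (Fintype.card K - 1) - 1) / d) := by
      have hq' : (Fintype.card K : ℂ) - 1 ≠ 0 := sub_ne_zero.2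
        (by exact_mod_cast (Fintype.one_lt_card (α := K)).ne')
      have hk := key b
      rw [hS] at hk
      simp only [eq_ratCast]
      push_cast
      rw [← hk]
      field_simp
      ring
    rw [hrat, isIntegral_algebraMap_iff (algebraMap ℚ ℂ).injective,
      IsIntegrallyClosed.isIntegral_iff] at hη
    obtain ⟨e, he⟩ := hη
    refine ⟨e, ?_⟩
    rw [hS, hrat, ← he]
    simp
  choose e he using hint
  refine ⟨e, fun b => ⟨he b, ?_⟩⟩
  have := key b
  rw [he b] at this
  exact_mod_cast this

end PowerSums

section TwoWeight

variable {K F : Type} [Field K] [Fintype K] [Field F] [Fintype F] [Algebra K F]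

theorem trace_mul_norm_ne_zero_iff (β : F) (x y : Fˣ) :
    Algebra.trace K F (β * ((x * y ^ ((Fintype.card F - 1) / (Fintype.card K - 1)) : Fˣ) : F)) ≠ 0
      ↔ Algebra.trace K F (β * (x : F)) ≠ 0 := by
  have hM : (Fintype.card F - 1) / (Fintype.card K - 1)
      = ∑ i ∈ Finset.range (Module.finrank K F), Nat.card K ^ i := by
    rw [Nat.card_eq_fintype_card, Nat.geomSum_eq Fintype.one_lt_card,
      Module.card_eq_pow_finrank (K := K) (V := F)]
  have h : β * ((x * y ^ ((Fintype.card F - 1) / (Fintype.card K - 1)) : Fˣ) : F)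
      = Algebra.norm K (y : F) • (β * (x : F)) := by
    rw [Algebra.smul_def, FiniteField.algebraMap_norm_eq_pow_sum, ← hM]
    push_cast
    ring
  rw [h, map_smul, smul_eq_mul, mul_ne_zero_iff, and_iff_right_iff_imp]
  intro _
  exact Algebra.norm_ne_zero_iff.2 y.ne_zero

theorem mul_codewordWeight_add_traceZeroCount {α : Fˣ} (hα : ∀ x : Fˣ, x ∈ Subgroup.zpowers α)
    {N d : ℕ} (hN : N ∣ Fintype.card F - 1) (hd0 : 0 < d)
    (hd : N.gcd ((Fintype.card F - 1) / (Fintype.card K - 1)) = d) (β : F) :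
    N * codewordWeight K F ((α ^ N : Fˣ) : F) ((Fintype.card F - 1) / N) β
      + traceZeroCount K d β = Fintype.card F := by
  set f : Fˣ → ℕ := fun x => if Algebra.trace K F (β * (x : F)) ≠ 0 then 1 else 0 with hf
  have h1 : N * codewordWeight K F ((α ^ N : Fˣ) : F) ((Fintype.card F - 1) / N) β
      = ∑ x : Fˣ, f (x ^ N) := by
    rw [sum_pow_eq_nsmul_sum_range hα (by rwa [Fintype.card_units]), Fintype.card_units,
      smul_eq_mul, codewordWeight, Finset.card_filter, Finset.sum_range]
    simp [hf]
  have h2 := sum_pow_eq_sum_pow_gcd (f := f) (hd ▸ hd0) fun x y => by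
    simp only [hf, trace_mul_norm_ne_zero_iff]
  rw [h1, h2, hd, traceZeroCount, Finset.card_filter,
    sum_eq_zero_add_sum_units (F := F), add_left_comm,
    ← Finset.sum_add_distrib]
  have h3 : ∀ x : Fˣ, f (x ^ d) + (if Algebra.trace K F (β * (x : F) ^ d) = 0 then 1 else 0)
      = 1 := by
    intro x
    simp only [hf, Units.val_pow_eq_pow_val]
    split_ifs <;> simp_all
  simp only [h3]
  have := Fintype.card_pos (α := F)
  simp [hd0.ne', Fintype.card_units]
  omega

theorem exists_pow_eq_algebraMap {α : Fˣ} (hα : ∀ x : Fˣ, x ∈ Subgroup.zpowers α) {d : ℕ}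
    (hd0 : d ≠ 0) (hd : d ∣ (Fintype.card F - 1) / (Fintype.card K - 1)) (c : K) :
    ∃ y : F, y ^ d = algebraMap K F c := by
  by_cases hc : c = 0
  · exact ⟨0, by simp [hc, hd0]⟩
  have hdvd : Fintype.card K - 1 ∣ Fintype.card F - 1 := by
    rw [Module.card_eq_pow_finrank (K := K) (V := F)]
    simpa using Nat.sub_dvd_pow_sub_pow (Fintype.card K) 1 (Module.finrank K F)
  let u : Fˣ := Units.map (algebraMap K F).toMonoidHom (Units.mk0 c hc)
  have hu : (u : F) = algebraMap K F c := rfl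
  obtain ⟨i, hi⟩ : u ∈ Submonoid.powers α := mem_powers_iff_mem_zpowers.2 (hα u)
  have h1 : α ^ (i * (Fintype.card K - 1)) = 1 := by
    rw [pow_mul]
    change (fun x => α ^ x) i ^ _ = 1
    rw [hi]
    ext
    rw [Units.val_pow_eq_pow_val, hu, ← map_pow, FiniteField.pow_card_sub_one_eq_one c hc]
    simp
  have h2 := orderOf_dvd_of_pow_eq_one h1
  rw [orderOf_eq_card_of_forall_mem_zpowers hα, Nat.card_eq_fintype_card, Fintype.card_units,
    ← Nat.div_mul_cancel hdvd] at h2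
  have hq : 0 < Fintype.card K - 1 := Nat.sub_pos_of_lt Fintype.one_lt_card
  obtain ⟨j, hj⟩ := hd.trans (Nat.dvd_of_mul_dvd_mul_right hq h2)
  refine ⟨((α ^ j : Fˣ) : F), ?_⟩
  rw [← hu, ← hi]
  simp only [hj, Units.val_pow_eq_pow_val]
  rw [← pow_mul, mul_comm]

omit [Fintype K] [Algebra K F] [Field K] in
theorem pow_ne_generator_pow {α : Fˣ} (hα : ∀ x : Fˣ, x ∈ Subgroup.zpowers α) {d : ℕ}
    (hd : d ∣ Fintype.card F - 1) {c : ℕ} (hc : ¬ d ∣ c) (x : F) :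
    x ^ d ≠ ((α ^ c : Fˣ) : F) := by
  intro h
  have hd0 : d ≠ 0 := by
    rintro rfl
    have := Fintype.one_lt_card (α := F)
    rw [zero_dvd_iff] at hd
    omega
  have hx : x ≠ 0 := by
    rintro rfl
    rw [zero_pow hd0] at h
    exact (α ^ c).ne_zero h.symm
  obtain ⟨i, hi⟩ : Units.mk0 x hx ∈ Submonoid.powers α := mem_powers_iff_mem_zpowers.2 (hα _)
  have h1 : α ^ (i * d) = α ^ c := by
    rw [pow_mul]
    change (fun x => α ^ x) i ^ _ = _
    rw [hi]
    ext
    rw [Units.val_pow_eq_pow_val, ← h, Units.val_mk0]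
  rw [pow_eq_pow_iff_modEq, orderOf_eq_card_of_forall_mem_zpowers hα, Nat.card_eq_fintype_card,
    Fintype.card_units] at h1
  exact hc ((h1.dvd_iff hd).1 (dvd_mul_left d i))

/-- The values of the quartic power sums on the four cosets of the fourth powers, in the case
where the cosets of `α` and `α ^ 3` are conjugate. -/
theorem quartic_values {T₀ T₁ T₂ T₃ r : ℤ} (h31 : T₃ = T₁) (hsum : T₀ + T₁ + T₂ + T₃ = 0)
    (hc₁ : T₀ * T₁ + T₁ * T₂ + T₂ * T₃ + T₃ * T₀ = -4 * r)
    (hc₂ : T₀ * T₂ + T₁ * T₃ + T₂ * T₀ + T₃ * T₁ = -4 * r) :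
    T₁ ^ 2 = r ∧ (T₀ = T₁ ∧ T₂ = -3 * T₁ ∨ T₀ = -3 * T₁ ∧ T₂ = T₁) := by
  subst h31
  have h2 : T₂ = -2 * T₃ - T₀ := by linarith
  subst h2
  have h1 : T₃ ^ 2 = r := by linarith
  refine ⟨h1, ?_⟩
  have h : (T₀ - T₃) * (T₀ + 3 * T₃) = 0 := by subst h1; linarith
  rcases mul_eq_zero.1 h with h | h
  · left; constructor <;> linarith
  · right; constructor <;> linarith

/-- A square root of `p ^ (2 * l)` that is `1` modulo `4`, for `p ≡ 3 (mod 4)`. -/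
theorem eq_neg_one_pow_mul_of_sq_eq {p l : ℕ} (hp : p % 4 = 3) {τ e : ℤ} (he : τ = 1 + 4 * e)
    (hτ : τ ^ 2 = ((p ^ l : ℕ) : ℤ) ^ 2) : τ = (-1) ^ l * ((p ^ l : ℕ) : ℤ) := by
  have hpe : (4 : ℤ) ∣ (p : ℤ) - (-1) := by omega
  have h := hpe.trans (sub_dvd_pow_sub_pow (p : ℤ) (-1) l)
  push_cast at hτ ⊢
  generalize (p : ℤ) ^ l = t at *
  rcases sq_eq_sq_iff_eq_or_eq_neg.1 hτ with rfl | rfl <;>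
    rcases neg_one_pow_eq_or ℤ l with h' | h' <;> rw [h'] at h ⊢ <;> omega

end TwoWeight

/-- if `N₂ = 4` and `p ≡ 3 (mod 4)` then `k = sm` is even and
`C(r,N)` is a two-weight code: `(r-1)/4` nonzero codewords have weight
`(q-1)(r+(-1)^{k/2}·3√r)/(Nq)` and `3(r-1)/4` have weight
`(q-1)(r-(-1)^{k/2}·√r)/(Nq)`. -/
theorem stmt19 (p s m N q r n k : ℕ) (hp : p.Prime) (hs : 0 < s) (hm : 0 < m)
    (hq : q = p ^ s) (hr : r = q ^ m) (hk : k = s * m)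
    (hN : N ∣ r - 1) (hn : n = (r - 1) / N)
    (hN₂ : Nat.gcd N ((r - 1) / (q - 1)) = 4) (hp4 : p % 4 = 3)
    (K F : Type) [Field K] [Fintype K] [Field F] [Fintype F] [Algebra K F]
    (hcardK : Fintype.card K = q) (hcardF : Fintype.card F = r)
    (α : Fˣ) (hα : ∀ x : Fˣ, x ∈ Subgroup.zpowers α)
    (hθ : ∀ x : F, x ∈ Algebra.adjoin K {((α ^ N : Fˣ) : F)}) :
    2 ∣ k ∧ ∃ t : ℕ, t ^ 2 = r ∧
      (Finset.univ.filter fun β : Fˣ =>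
          ((N * q * codewordWeight K F ((α ^ N : Fˣ) : F) n (β : F) : ℕ) : ℤ) =
            ((q : ℤ) - 1) * ((r : ℤ) + (-1) ^ (k / 2) * 3 * (t : ℤ))).card =
        (r - 1) / 4 ∧
      (Finset.univ.filter fun β : Fˣ =>
          ((N * q * codewordWeight K F ((α ^ N : Fˣ) : F) n (β : F) : ℕ) : ℤ) =
            ((q : ℤ) - 1) * ((r : ℤ) - (-1) ^ (k / 2) * (t : ℤ))).card =
        3 * (r - 1) / 4 := by
  subst hn hk
  have hFu : Fintype.card Fˣ = r - 1 := by rw [Fintype.card_units, hcardF]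
  have hM4 : 4 ∣ (Fintype.card F - 1) / (Fintype.card K - 1) := by
    rw [hcardF, hcardK, ← hN₂]
    exact Nat.gcd_dvd_right _ _
  have h4r : 4 ∣ r - 1 := (hN₂ ▸ Nat.gcd_dvd_left N ((r - 1) / (q - 1)) : 4 ∣ N).trans hN
  have hr1 : 1 < r := hcardF ▸ Fintype.one_lt_card
  have hq1 : 1 < q := hcardK ▸ Fintype.one_lt_card
  have hrp : r = p ^ (s * m) := by rw [hr, hq, pow_mul]
  have heven : 2 ∣ s * m := by
    rw [← even_iff_two_dvd]
    by_contra hodd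
    rw [Nat.not_even_iff_odd] at hodd
    obtain ⟨l, hl⟩ := hodd
    have h : p ^ (2 * l + 1) % 4 = 3 := by
      rw [pow_succ, pow_mul, Nat.mul_mod, Nat.pow_mod, Nat.pow_mod p, hp4]
      simp
    rw [← hl, ← hrp] at h
    omega
  refine ⟨heven, ?_⟩
  obtain ⟨l, hl⟩ := heven
  have hl2 : s * m / 2 = l := by omega
  have hrt : r = (p ^ l) ^ 2 := by rw [hrp, hl, ← pow_mul, mul_comm]
  refine ⟨p ^ l, hrt.symm, ?_⟩
  rw [hl2]
  have : Fact p.Prime := ⟨hp⟩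
  have : CharP F p := charP_of_card_eq_prime_pow (f := s * m) (by rw [hcardF, hrp])
  have hχ := AddChar.FiniteField.primitiveChar_to_Complex_isPrimitive K
  set χ := AddChar.FiniteField.primitiveChar_to_Complex K
  have hψ := isPrimitive_comp_trace (F := F) hχ
  obtain ⟨e, he⟩ := exists_int_powerCharSum_eq (F := F) hχ four_ne_zero (hFu ▸ h4r)
    (exists_pow_eq_algebraMap hα four_ne_zero hM4)
  set ψ := χ.compAddMonoidHom (Algebra.trace K F).toAddMonoidHom
  set T : Fˣ → ℤ := fun b => 1 + (4 : ℕ) * e b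
  have hTS : ∀ b : Fˣ, powerCharSum ψ 4 (b : F) = (T b : ℂ) := fun b => (he b).1
  have hTA : ∀ b : Fˣ, ((q : ℤ) - 1) * T b = q * traceZeroCount K 4 (b : F) - r := fun b => by
    rw [← hcardK, ← hcardF]
    exact (he b).2
  have hTinv : ∀ x y : Fˣ, T (x * y ^ 4) = T x := by
    intro x y
    have h := powerCharSum_mul_pow ψ 4 (x : F) y.ne_zero
    rw [hTS, ← Units.val_pow_eq_pow_val, ← Units.val_mul, hTS] at h
    exact_mod_cast h
  have hweight : ∀ b : Fˣ, ((N * q * codewordWeight K F ((α ^ N : Fˣ) : F) ((r - 1) / N) (b : F)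
      : ℕ) : ℤ) = ((q : ℤ) - 1) * ((r : ℤ) - T b) := by
    intro b
    have h := mul_codewordWeight_add_traceZeroCount (K := K) (N := N) (d := 4) hα
      (by rwa [hcardF]) (by norm_num) (by rwa [hcardF, hcardK]) (b : F)
    rw [hcardF] at h
    have h' := congrArg (Nat.cast : ℕ → ℤ) h
    push_cast at h' ⊢
    linear_combination (q : ℤ) * h' + hTA b
  have hfrob : T (α ^ 3) = T (α ^ 1) := by
    have h1 : T (α ^ p) = T (α ^ 1) := by
      refine mul_left_cancel₀ (by omega : (q : ℤ) - 1 ≠ 0) ?_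
      rw [hTA, hTA, pow_one, Units.val_pow_eq_pow_val, traceZeroCount_pow_char]
    rw [← h1, ← hTinv (α ^ 3) (α ^ (p / 4)), ← pow_mul, ← pow_add]
    congr 2
    omega
  have hneg : ∃ y : Fˣ, y ^ 4 = -1 := by
    have h8 : 8 ∣ r - 1 := by
      have hodd : Odd (p ^ l) := (Nat.odd_iff.2 (by omega)).pow
      rw [hrt]
      exact Nat.eight_dvd_sq_sub_one_of_odd hodd
    obtain ⟨c, hc⟩ := h8
    refine ⟨α ^ c, ?_⟩
    have ho : orderOf α = 8 * c := by
      rw [orderOf_eq_card_of_forall_mem_zpowers hα, Nat.card_eq_fintype_card, hFu, hc]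
    rw [← pow_mul]
    have h1 : (((α ^ (c * 4) : Fˣ) : F)) * ((α ^ (c * 4) : Fˣ) : F) = 1 := by
      rw [← Units.val_mul, ← pow_add, ← mul_add, mul_comm, ← ho, pow_orderOf_eq_one, Units.val_one]
    rcases mul_self_eq_one_iff.1 h1 with h | h
    · exact absurd (Units.ext h) (pow_ne_one_of_lt_orderOf (by omega) (by omega))
    · exact Units.ext h
  obtain ⟨i, hi⟩ := hneg
  have hcoset : ∀ {A : Type} [AddCommMonoid A] (g : ℤ → ℤ → A) (c : ℕ),
      ∑ b, g (T b) (T (α ^ c * b)) = ((r - 1) / 4) •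
        ∑ i ∈ Finset.range 4, g (T (α ^ i)) (T (α ^ (c + i))) := by
    intro A _ g c
    have h := sum_eq_nsmul_sum_cosets hα (hFu ▸ h4r) (f := fun b => g (T b) (T (α ^ c * b)))
      fun x y => by rw [← mul_assoc, hTinv, hTinv]
    rw [h, hFu]
    simp only [pow_add]
  have hT4 : ∀ c, T (α ^ (c + 4)) = T (α ^ c) := fun c => by rw [pow_add, hTinv]
  obtain ⟨R, hR⟩ := h4r
  have hR4 : (r - 1) / 4 = R := by omega
  have hRr : (r : ℤ) = 4 * R + 1 := by omega
  have hR0 : (R : ℤ) ≠ 0 := by omega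
  have hsum : T (α ^ 0) + T (α ^ 1) + T (α ^ 2) + T (α ^ 3) = 0 := by
    have h := sum_powerCharSum hψ four_ne_zero
    rw [sum_eq_zero_add_sum_units, powerCharSum_zero, add_eq_left] at h
    simp only [hTS] at h
    have h2 := hcoset (fun x _ => x) 0
    rw [show ∑ b, T b = 0 by exact_mod_cast h, hR4] at h2
    simp only [Finset.sum_range_succ, Finset.sum_range_zero, nsmul_eq_mul, zero_add] at h2
    exact (mul_eq_zero.1 h2.symm).resolve_left hR0
  have hcorr : ∀ c, ¬ 4 ∣ c →
      ∑ i ∈ Finset.range 4, T (α ^ i) * T (α ^ (c + i)) = -4 * r := by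
    intro c hc
    have h := sum_powerCharSum_mul_powerCharSum hψ four_ne_zero
      (pow_ne_generator_pow hα (hcardF ▸ ⟨R, hR⟩) hc)
    rw [sum_eq_zero_add_sum_units, mul_zero, neg_zero, powerCharSum_zero, hcardF] at h
    have h1 : ∀ b : Fˣ, powerCharSum ψ 4 (-(((α ^ c : Fˣ) : F) * b)) = T (α ^ c * b) := by
      intro b
      rw [← hTinv (α ^ c * b) i, hi, ← hTS]
      simp
    simp only [hTS, h1] at h
    have h2 := hcoset (fun x y => x * y) c
    have h3 : (r : ℤ) * r + ∑ b, T b * T (α ^ c * b) = r := by exact_mod_cast h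
    rw [h2, hR4, nsmul_eq_mul] at h3
    refine mul_left_cancel₀ hR0 ?_
    rw [hRr] at h3 ⊢
    linear_combination h3
  have hc₁ := hcorr 1 (by norm_num)
  have hc₂ := hcorr 2 (by norm_num)
  simp only [Finset.sum_range_succ, Finset.sum_range_zero, zero_add, add_zero, Nat.reduceAdd,
    hT4 0, hT4 1] at hc₁ hc₂
  obtain ⟨hsq, hval⟩ := quartic_values hfrob hsum hc₁ hc₂
  have hτ := eq_neg_one_pow_mul_of_sq_eq (l := l) hp4 (τ := T (α ^ 1)) (e := e (α ^ 1 : Fˣ)) rfl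
    (by rw [hsq, hrt]; push_cast; ring)
  have hτ0 : T (α ^ 1) ≠ 0 := by
    intro h0
    rw [h0] at hsq
    omega
  have hcount : ∀ v : ℤ, (Finset.univ.filter fun b : Fˣ => T b = v).card
      = R * ∑ i ∈ Finset.range 4, if T (α ^ i) = v then 1 else 0 := by
    intro v
    rw [Finset.card_filter]
    have h := hcoset (fun x _ => if x = v then 1 else 0) 0
    rwa [hR4, smul_eq_mul] at h
  have hq0 : (q : ℤ) - 1 ≠ 0 := by omega
  have hiff : ∀ (b : Fˣ) (v w : ℤ), w = r - v → (((N * q *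
      codewordWeight K F ((α ^ N : Fˣ) : F) ((r - 1) / N) (b : F) : ℕ) : ℤ)
        = ((q : ℤ) - 1) * w ↔ T b = v) := by
    rintro b v w rfl
    rw [hweight, mul_right_inj' hq0, sub_right_inj]
  have hne : -3 * T (α ^ 1) ≠ T (α ^ 1) := by omega
  have hne' : T (α ^ 1) ≠ -3 * T (α ^ 1) := hne.symm
  simp only [fun b => hiff b (-3 * T (α ^ 1)) (r + (-1) ^ l * 3 * ((p ^ l : ℕ) : ℤ))
    (by rw [hτ]; ring), fun b => hiff b (T (α ^ 1)) (r - (-1) ^ l * ((p ^ l : ℕ) : ℤ))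
    (by rw [hτ]), hcount]
  simp only [Finset.sum_range_succ, Finset.sum_range_zero, zero_add, hfrob]
  rcases hval with ⟨h0, h2⟩ | ⟨h0, h2⟩ <;> rw [h0, h2] <;> simp only [hne, hne', if_true, if_false]
    <;> constructor <;> omega
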